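/- arXiv:1308.1075 — 2 statements merged into one kernel-verified Lean document; each statement's English description precedes it below -/
import Mathlib

section
/- The group of permutations of a 4×4 array generated by all permutations of the four rows, all permutations of the four columns, and all permutations of the four 2×2 quadrants has order 322,560. -/
/-- Split an element of `Fin 4` into its high and low binary bits. -/
def bits : Fin 4 ≃ Fin 2 × Fin 2 :=
  ⟨fun i => (⟨i.val / 2, by omega⟩, ⟨i.val % 2, by omega⟩),
   fun p => ⟨2 * p.1.val + p.2.val, by omega⟩,
   by decide, by decide⟩

/-- Regroup `((i₁,i₀),(j₁,j₀))` as `((i₁,j₁),(i₀,j₀))` : (block, position within block). -/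
def regroup : (Fin 2 × Fin 2) × (Fin 2 × Fin 2) ≃ (Fin 2 × Fin 2) × (Fin 2 × Fin 2) :=
  ⟨fun p => ((p.1.1, p.2.1), (p.1.2, p.2.2)),
   fun p => ((p.1.1, p.2.1), (p.1.2, p.2.2)),
   by decide, by decide⟩

/-- Identify a cell `(i,j)` with (its 2×2 quadrant, its position within that quadrant). -/
def toBlocks : Fin 4 × Fin 4 ≃ (Fin 2 × Fin 2) × (Fin 2 × Fin 2) :=
  (bits.prodCongr bits).trans regroup

/-- Row permutation of the 4×4 array. -/
def rowPerm (σ : Equiv.Perm (Fin 4)) : Equiv.Perm (Fin 4 × Fin 4) :=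
  σ.prodCongr (Equiv.refl (Fin 4))

/-- Column permutation of the 4×4 array. -/
def colPerm (τ : Equiv.Perm (Fin 4)) : Equiv.Perm (Fin 4 × Fin 4) :=
  (Equiv.refl (Fin 4)).prodCongr τ

/-- Quadrant permutation: permute the four 2×2 quadrants rigidly according to `ρ`. -/
def quadPerm (ρ : Equiv.Perm (Fin 2 × Fin 2)) : Equiv.Perm (Fin 4 × Fin 4) :=
  toBlocks.permCongr.symm (ρ.prodCongr (Equiv.refl (Fin 2 × Fin 2)))

/-- The group generated by row, column and quadrant permutations. -/
def diamondGroup : Subgroup (Equiv.Perm (Fin 4 × Fin 4)) :=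
  Subgroup.closure {p | (∃ σ, p = rowPerm σ) ∨ (∃ τ, p = colPerm τ) ∨ (∃ ρ, p = quadPerm ρ)}

abbrev DV : Type := Fin 4 → ZMod 2

/-- binary coordinates of a cell -/
def cellVec : Fin 4 × Fin 4 ≃ DV :=
  ⟨fun x => ![(bits x.1).1, (bits x.1).2, (bits x.2).1, (bits x.2).2],
   fun v => (bits.symm (v 0, v 1), bits.symm (v 2, v 3)),
   fun x => by simp,
   fun v => by ext i; fin_cases i <;> simp⟩

def bitsZ (i : Fin 4) : ZMod 2 × ZMod 2 := bits i

def pairZ (i : Fin 2 × Fin 2) : ZMod 2 × ZMod 2 := i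

lemma perm4_affine : ∀ (σ : Equiv.Perm (Fin 4)) (x y z w : Fin 4),
    bitsZ x + bitsZ y + bitsZ z = bitsZ w →
    bitsZ (σ x) + bitsZ (σ y) + bitsZ (σ z) = bitsZ (σ w) := by
  decide +kernel

lemma perm22_affine : ∀ (σ : Equiv.Perm (Fin 2 × Fin 2)) (x y z w : Fin 2 × Fin 2),
    pairZ x + pairZ y + pairZ z = pairZ w →
    pairZ (σ x) + pairZ (σ y) + pairZ (σ z) = pairZ (σ w) := by
  decide +kernel

lemma cellVec_rel (x y z w : Fin 4 × Fin 4) :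
    cellVec x + cellVec y + cellVec z = cellVec w ↔
      bitsZ x.1 + bitsZ y.1 + bitsZ z.1 = bitsZ w.1 ∧
      bitsZ x.2 + bitsZ y.2 + bitsZ z.2 = bitsZ w.2 := by
  rw [funext_iff, Fin.forall_fin_succ, Fin.forall_fin_succ, Fin.forall_fin_succ,
    Fin.forall_fin_succ, Prod.ext_iff, Prod.ext_iff]
  constructor
  · rintro ⟨a, b, c, d, -⟩
    exact ⟨⟨a, b⟩, ⟨c, d⟩⟩
  · rintro ⟨⟨a, b⟩, ⟨c, d⟩⟩
    exact ⟨a, b, c, d, fun i => i.elim0⟩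

lemma cellVec_rel' (x y z w : Fin 4 × Fin 4) :
    cellVec x + cellVec y + cellVec z = cellVec w ↔
      pairZ (toBlocks x).1 + pairZ (toBlocks y).1 + pairZ (toBlocks z).1 = pairZ (toBlocks w).1 ∧
      pairZ (toBlocks x).2 + pairZ (toBlocks y).2 + pairZ (toBlocks z).2
        = pairZ (toBlocks w).2 := by
  rw [funext_iff, Fin.forall_fin_succ, Fin.forall_fin_succ, Fin.forall_fin_succ,
    Fin.forall_fin_succ, Prod.ext_iff, Prod.ext_iff]
  constructor
  · rintro ⟨a, b, c, d, -⟩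
    exact ⟨⟨a, c⟩, ⟨b, d⟩⟩
  · rintro ⟨⟨a, c⟩, ⟨b, d⟩⟩
    exact ⟨a, b, c, d, fun i => i.elim0⟩

def Aff (p : Equiv.Perm (Fin 4 × Fin 4)) : Prop :=
  ∀ x y z w, cellVec x + cellVec y + cellVec z = cellVec w →
    cellVec (p x) + cellVec (p y) + cellVec (p z) = cellVec (p w)

lemma aff_of_mem {p : Equiv.Perm (Fin 4 × Fin 4)} (hp : p ∈ diamondGroup) : Aff p := by
  induction hp using Subgroup.closure_induction with
  | mem p hp =>
    intro x y z w h
    rcases hp with ⟨σ, rfl⟩ | ⟨σ, rfl⟩ | ⟨σ, rfl⟩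
    · rw [cellVec_rel] at *
      exact ⟨perm4_affine σ _ _ _ _ h.1, h.2⟩
    · rw [cellVec_rel] at *
      exact ⟨h.1, perm4_affine σ _ _ _ _ h.2⟩
    · rw [cellVec_rel'] at *
      have key : ∀ x, toBlocks (quadPerm σ x) = (σ (toBlocks x).1, (toBlocks x).2) := by
        intro x; simp [quadPerm, Equiv.permCongr]; rfl
      simp only [key]
      exact ⟨perm22_affine σ _ _ _ _ h.1, h.2⟩
  | one => exact fun x y z w h => h
  | mul p q _ _ hp hq => exact fun x y z w h => hp _ _ _ _ (hq _ _ _ _ h)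
  | inv p _ hp =>
    intro x y z w h
    have := hp (p⁻¹ x) (p⁻¹ y) (p⁻¹ z)
      (cellVec.symm (cellVec (p⁻¹ x) + cellVec (p⁻¹ y) + cellVec (p⁻¹ z))) (by simp)
    simp only [← Equiv.Perm.mul_apply, mul_inv_cancel, Equiv.Perm.one_apply] at this
    rw [h] at this
    have h2 := cellVec.injective this
    rw [h2]
    simp

/-- The affine map `x ↦ L x + v`, transported to cells. -/
def affPerm (q : DV × (DV ≃ₗ[ZMod 2] DV)) : Equiv.Perm (Fin 4 × Fin 4) :=
  cellVec.permCongr.symm (q.2.toEquiv.trans (Equiv.addRight q.1))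

lemma cellVec_affPerm (q) (x) : cellVec (affPerm q x) = q.2 (cellVec x) + q.1 := by
  simp [affPerm, Equiv.permCongr]

lemma affPerm_injective : Function.Injective affPerm := by
  rintro ⟨v, L⟩ ⟨v', L'⟩ h
  have h1 : ∀ u : DV, L u + v = L' u + v' := by
    intro u
    have := congrArg (fun p => cellVec (p (cellVec.symm u))) h
    simpa [cellVec_affPerm] using this
  have h0 : v = v' := by simpa using h1 0
  subst h0
  congr 1
  ext1 u
  exact add_right_cancel (h1 u)

lemma exists_of_aff {p : Equiv.Perm (Fin 4 × Fin 4)} (hp : Aff p) : ∃ q, affPerm q = p := by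
  set F : DV → DV := fun u => cellVec (p (cellVec.symm u)) with hF
  have hFi : Function.Injective F :=
    cellVec.injective.comp (p.injective.comp cellVec.symm.injective)
  have two : ∀ a : DV, a + a = 0 := fun a => by
    ext i; exact CharTwo.add_self_eq_zero _
  have hadd : ∀ a b, F a + F b + F 0 = F (a + b) := by
    intro a b
    exact hp _ _ _ _ (by simp)
  let f : DV →+ DV := AddMonoidHom.mk' (fun u => F u + F 0) (by
    intro a b
    rw [← hadd]
    abel)
  have hfi : Function.Injective (f.toZModLinearMap 2) := by
    intro a b h
    exact hFi (add_right_cancel (b := F 0) h)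
  refine ⟨(F 0, LinearEquiv.ofInjectiveEndo (f.toZModLinearMap 2) hfi), ?_⟩
  ext1 x
  apply cellVec.injective
  rw [cellVec_affPerm]
  change F (cellVec x) + F 0 + F 0 = _
  rw [add_assoc, two, add_zero]
  simp [hF]

def Real' (M : Matrix (Fin 4) (Fin 4) (ZMod 2)) : Prop :=
  ∃ g ∈ diamondGroup, ∀ x, cellVec (g x) = M.mulVec (cellVec x)

lemma Real'.mul {M N} (hM : Real' M) (hN : Real' N) : Real' (M * N) := by
  obtain ⟨g, hg, h⟩ := hM
  obtain ⟨g', hg', h'⟩ := hN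
  refine ⟨g * g', mul_mem hg hg', fun x => ?_⟩
  rw [Equiv.Perm.mul_apply, h, h', Matrix.mulVec_mulVec]

lemma row_mem (σ) : rowPerm σ ∈ diamondGroup := Subgroup.subset_closure (Or.inl ⟨σ, rfl⟩)
lemma col_mem (σ) : colPerm σ ∈ diamondGroup := Subgroup.subset_closure (Or.inr (Or.inl ⟨σ, rfl⟩))
lemma quad_mem (σ) : quadPerm σ ∈ diamondGroup :=
  Subgroup.subset_closure (Or.inr (Or.inr ⟨σ, rfl⟩))

lemma real_one : Real' 1 := ⟨1, one_mem _, fun x => by simp⟩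

lemma real01 : Real' (Matrix.transvection 0 1 1) :=
  ⟨rowPerm (Equiv.swap 1 3), row_mem _, by decide +kernel⟩
lemma real10 : Real' (Matrix.transvection 1 0 1) :=
  ⟨rowPerm (Equiv.swap 2 3), row_mem _, by decide +kernel⟩
lemma real23 : Real' (Matrix.transvection 2 3 1) :=
  ⟨colPerm (Equiv.swap 1 3), col_mem _, by decide +kernel⟩
lemma real32 : Real' (Matrix.transvection 3 2 1) :=
  ⟨colPerm (Equiv.swap 2 3), col_mem _, by decide +kernel⟩
lemma real02 : Real' (Matrix.transvection 0 2 1) :=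
  ⟨quadPerm (Equiv.swap (0, 1) (1, 1)), quad_mem _, by decide +kernel⟩
lemma real20 : Real' (Matrix.transvection 2 0 1) :=
  ⟨quadPerm (Equiv.swap (1, 0) (1, 1)), quad_mem _, by decide +kernel⟩

lemma real_comm {i j k : Fin 4} (h : i ≠ j ∧ j ≠ k ∧ i ≠ k)
    (h1 : Real' (Matrix.transvection i j 1)) (h2 : Real' (Matrix.transvection j k 1)) :
    Real' (Matrix.transvection i k 1) := by
  have : (Matrix.transvection i k 1 : Matrix (Fin 4) (Fin 4) (ZMod 2)) =
      Matrix.transvection i j 1 * Matrix.transvection j k 1 *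
        (Matrix.transvection i j 1 * Matrix.transvection j k 1) := by
    clear h1 h2
    revert i j k
    decide +kernel
  rw [this]
  exact (h1.mul h2).mul (h1.mul h2)

lemma off_diag (P : Fin 4 → Fin 4 → Prop) (h01 : P 0 1) (h02 : P 0 2) (h03 : P 0 3)
    (h10 : P 1 0) (h12 : P 1 2) (h13 : P 1 3) (h20 : P 2 0) (h21 : P 2 1) (h23 : P 2 3)
    (h30 : P 3 0) (h31 : P 3 1) (h32 : P 3 2) (i j : Fin 4) (h : i ≠ j) : P i j := by
  fin_cases i <;> fin_cases j <;> first | assumption | exact absurd rfl h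

lemma real_transvection (i j : Fin 4) (h : i ≠ j) : Real' (Matrix.transvection i j 1) := by
  have h03 := real_comm (by decide) real02 real23
  have h12 := real_comm (by decide) real10 real02
  have h13 := real_comm (by decide) h12 real23
  have h21 := real_comm (by decide) real20 real01
  have h30 := real_comm (by decide) real32 real20
  have h31 := real_comm (by decide) h30 real01
  exact off_diag (fun i j => Real' (Matrix.transvection i j 1)) real01 real02 h03 real10 h12 h13
    real20 h21 real23 h30 h31 real32 i j h

lemma real_of_det (M : Matrix (Fin 4) (Fin 4) (ZMod 2)) (hM : M.det ≠ 0) : Real' M := by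
  have z2 : ∀ c : ZMod 2, c = 0 ∨ c = 1 := by decide
  refine Matrix.diagonal_transvection_induction_of_det_ne_zero Real' M hM ?_ ?_ ?_
  · intro D hD
    have : D = 1 := by
      rw [Matrix.det_diagonal, Finset.prod_ne_zero_iff] at hD
      ext i
      exact (z2 (D i)).resolve_left (hD i (Finset.mem_univ i))
    rw [this]
    simpa using real_one
  · rintro ⟨i, j, hij, c⟩
    rcases z2 c with rfl | rfl
    · simpa [Matrix.TransvectionStruct.toMatrix] using real_one
    · exact real_transvection i j hij
  · exact fun A B _ _ hA hB => hA.mul hB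

lemma translate_mem : ∀ v : DV, ∃ g ∈ diamondGroup, ∀ x, cellVec (g x) = cellVec x + v := by
  intro v
  refine ⟨rowPerm (bits.permCongr.symm ((Equiv.addRight (v 0 : Fin 2)).prodCongr
      (Equiv.addRight (v 1 : Fin 2)))) *
    colPerm (bits.permCongr.symm ((Equiv.addRight (v 2 : Fin 2)).prodCongr
      (Equiv.addRight (v 3 : Fin 2)))), mul_mem (row_mem _) (col_mem _), ?_⟩
  revert v
  decide +kernel

lemma affPerm_mem (q) : affPerm q ∈ diamondGroup := by
  obtain ⟨g, hg, h⟩ := translate_mem q.1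
  obtain ⟨g', hg', h'⟩ := real_of_det (LinearMap.toMatrix' q.2.toLinearMap) (by
    rw [LinearMap.det_toMatrix']
    exact (LinearEquiv.isUnit_det' q.2).ne_zero)
  have : affPerm q = g * g' := by
    ext1 x
    apply cellVec.injective
    rw [cellVec_affPerm, Equiv.Perm.mul_apply, h, h', LinearMap.toMatrix'_mulVec]
    rfl
  rw [this]
  exact mul_mem hg hg'

theorem diamond_group_order : Nat.card diamondGroup = 322560 := by
  have e : (DV × (DV ≃ₗ[ZMod 2] DV)) ≃ diamondGroup :=
    Equiv.ofBijective (fun q => ⟨affPerm q, affPerm_mem q⟩)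
      ⟨fun a b h => affPerm_injective (congrArg Subtype.val h), fun p => by
        obtain ⟨q, hq⟩ := exists_of_aff (aff_of_mem p.2)
        exact ⟨q, Subtype.ext hq⟩⟩
  have e2 : Matrix.GeneralLinearGroup (Fin 4) (ZMod 2) ≃ (DV ≃ₗ[ZMod 2] DV) :=
    (Matrix.GeneralLinearGroup.toLin.trans
      (LinearMap.GeneralLinearGroup.generalLinearEquiv (ZMod 2) DV)).toEquiv
  rw [← Nat.card_congr e, Nat.card_prod, ← Nat.card_congr e2, Matrix.card_GL_field]
  simp [Fin.prod_univ_succ, ZMod.card]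
end

section
/- GL(4,2) is isomorphic to the alternating group A₈. -/
namespace GLA8
open Matrix Equiv

/-- The alternating matrix with the given upper-triangular entries. -/
def alt (a b c d e f : ZMod 2) : Matrix (Fin 4) (Fin 4) (ZMod 2) :=
  !![0, a, b, c; a, 0, d, e; b, d, 0, f; c, e, f, 0]

/-- Eight alternating forms on `F₂⁴` with all pairwise differences nondegenerate. -/
def v : Fin 8 → Matrix (Fin 4) (Fin 4) (ZMod 2) :=
  ![alt 0 0 0 0 0 0, alt 0 0 1 1 0 0, alt 0 1 0 1 1 0, alt 0 1 1 0 1 1,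
    alt 1 0 0 1 1 1, alt 1 0 1 0 0 1, alt 1 1 0 1 0 1, alt 1 1 1 0 1 0]

/-- The permutation induced by the transvection with entry `1` at `(i, j)`. -/
def tp (i j : Fin 4) : Perm (Fin 8) :=
  (![![1, swap 0 5 * swap 1 6 * swap 2 4 * swap 3 7, swap 0 7 * swap 1 2 * swap 3 5 * swap 4 6,
      swap 0 1 * swap 2 7 * swap 3 4 * swap 5 6],
    ![swap 0 4 * swap 1 5 * swap 2 6 * swap 3 7, 1, swap 0 1 * swap 2 7 * swap 3 6 * swap 4 5,
      swap 0 2 * swap 1 7 * swap 3 5 * swap 4 6],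
    ![swap 0 2 * swap 1 3 * swap 4 6 * swap 5 7, swap 0 1 * swap 2 3 * swap 4 7 * swap 5 6, 1,
      swap 0 6 * swap 1 5 * swap 2 4 * swap 3 7],
    ![swap 0 1 * swap 2 3 * swap 4 5 * swap 6 7, swap 0 3 * swap 1 2 * swap 4 6 * swap 5 7,
      swap 0 5 * swap 1 4 * swap 2 6 * swap 3 7, 1]] :
    Fin 4 → Fin 4 → Perm (Fin 8)) i j

/-- `M` permutes the eight forms by `σ`, up to a translation. -/
def Rel (M : Matrix (Fin 4) (Fin 4) (ZMod 2)) (σ : Perm (Fin 8)) : Prop :=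
  ∀ a, M * v a * Mᵀ = v (σ a) + v (σ 0)

lemma v_zero : v 0 = 0 := by decide +kernel

lemma two_zero (A : Matrix (Fin 4) (Fin 4) (ZMod 2)) : A + A = 0 := by
  ext i j
  exact CharTwo.add_self_eq_zero (A i j)

lemma rel_one : Rel 1 1 := by
  intro a
  simp [v_zero]

lemma rel_mul {M N : Matrix (Fin 4) (Fin 4) (ZMod 2)} {σ τ : Perm (Fin 8)}
    (hM : Rel M σ) (hN : Rel N τ) : Rel (M * N) (σ * τ) := by
  intro a
  have h : M * N * v a * (M * N)ᵀ = M * (N * v a * Nᵀ) * Mᵀ := by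
    simp only [Matrix.transpose_mul, Matrix.mul_assoc]
  rw [h, hN a, Matrix.mul_add, Matrix.add_mul, hM, hM, Perm.mul_apply, Perm.mul_apply,
    add_add_add_comm, two_zero, add_zero]

lemma tp_sign : ∀ i j, Perm.sign (tp i j) = 1 := by decide +kernel

lemma tp_rel : ∀ i j, i ≠ j → ∀ a,
    (1 + Matrix.of (fun k l => if i = k ∧ j = l then (1 : ZMod 2) else 0)) * v a *
    (1 + Matrix.of (fun k l => if i = k ∧ j = l then (1 : ZMod 2) else 0))ᵀ
      = v (tp i j a) + v (tp i j 0) := by decide +kernel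

lemma zmod_two : ∀ c : ZMod 2, c = 0 ∨ c = 1 := by decide

lemma exists_rel (M : Matrix (Fin 4) (Fin 4) (ZMod 2)) (hM : M.det ≠ 0) :
    ∃ σ : alternatingGroup (Fin 8), Rel M σ := by
  refine Matrix.diagonal_transvection_induction_of_det_ne_zero
    (fun M => ∃ σ : alternatingGroup (Fin 8), Rel M σ) M hM ?_ ?_ ?_
  · intro D hD
    have h : D = 1 := by
      funext i
      rw [Matrix.det_diagonal] at hD
      exact (zmod_two (D i)).resolve_left (Finset.prod_ne_zero_iff.1 hD i (Finset.mem_univ i))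
    subst h
    refine ⟨1, ?_⟩
    have : Matrix.diagonal (1 : Fin 4 → ZMod 2) = 1 := Matrix.diagonal_one
    rw [this]
    exact rel_one
  · rintro ⟨i, j, hij, c⟩
    rcases zmod_two c with rfl | rfl
    · refine ⟨1, ?_⟩
      simpa [TransvectionStruct.toMatrix] using rel_one
    · exact ⟨⟨tp i j, tp_sign i j⟩, tp_rel i j hij⟩
  · rintro A B - - ⟨σ, hσ⟩ ⟨τ, hτ⟩
    exact ⟨σ * τ, rel_mul hσ hτ⟩

lemma v_pairs : ∀ x y p q : Fin 8, v x + v p = v y + v q →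
    x = p ∨ (x = y ∧ p = q) ∨ (x = q ∧ y = p) := by decide +kernel

lemma rel_unique {M : Matrix (Fin 4) (Fin 4) (ZMod 2)} {σ τ : Perm (Fin 8)}
    (h1 : Rel M σ) (h2 : Rel M τ) : σ = τ := by
  have key : ∀ a, a ≠ 0 → (σ a = τ a ∧ σ 0 = τ 0) ∨ (σ a = τ 0 ∧ τ a = σ 0) := by
    intro a ha
    exact (v_pairs _ _ _ _ ((h1 a).symm.trans (h2 a))).resolve_left
      (fun h => ha (σ.injective h))
  have h0 : σ 0 = τ 0 := by
    by_contra hne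
    have e1 := (key 1 (by decide)).resolve_left (fun h => hne h.2)
    have e2 := (key 2 (by decide)).resolve_left (fun h => hne h.2)
    exact absurd (σ.injective (e1.1.trans e2.1.symm)) (by decide)
  ext1 a
  by_cases ha : a = 0
  · rw [ha, h0]
  · rcases key a ha with h | h
    · exact h.1
    · exact absurd (σ.injective (h.1.trans h0.symm)) ha

/-- The elementary alternating matrix. -/
def w (i j : Fin 4) : Matrix (Fin 4) (Fin 4) (ZMod 2) :=
  Matrix.single i j 1 + Matrix.single j i 1

lemma w_span : ∀ i j, ∃ c : Fin 8 → ZMod 2, w i j = ∑ a, c a • v a := by decide +kernel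

lemma columns : ∀ i j : Fin 4, ∀ x y : Fin 4 → ZMod 2,
    Matrix.of (fun k l : Fin 4 => x k * y l + y k * x l) = w i j →
      ∀ k : Fin 4, i = j ∨ k = i ∨ k = j ∨ x k = 0 := by
  decide +kernel

lemma third : ∀ i k : Fin 4, ∃ j, i ≠ j ∧ k ≠ j := by decide

lemma rel_one_right {M : Matrix (Fin 4) (Fin 4) (ZMod 2)} (h : Rel M 1) : M = 1 := by
  have hv : ∀ a, M * v a * Mᵀ = v a := by
    intro a
    simpa [v_zero] using h a
  have hw : ∀ i j, M * w i j * Mᵀ = w i j := by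
    intro i j
    obtain ⟨c, hc⟩ := w_span i j
    rw [hc, Matrix.mul_sum, Matrix.sum_mul]
    refine Finset.sum_congr rfl fun a _ => ?_
    rw [Matrix.mul_smul, Matrix.smul_mul, hv]
  have he : ∀ i j k l, M k i * M l j + M k j * M l i = w i j k l := by
    intro i j k l
    rw [← hw i j]
    simp [w, Matrix.mul_add, add_mul, Finset.sum_add_distrib, Matrix.mul_apply, Matrix.single_apply,
      Finset.sum_ite_eq, ite_and]
  have hoff : ∀ k i, k ≠ i → M k i = 0 := by
    intro k i hki
    obtain ⟨j, hij, hkj⟩ := third i k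
    have := columns i j (fun k => M k i) (fun k => M k j) (Matrix.ext (he i j)) k
    tauto
  ext k i
  by_cases hki : k = i
  · subst hki
    rw [Matrix.one_apply_eq]
    refine (zmod_two _).resolve_left fun h0 => ?_
    obtain ⟨j, hij, -⟩ := third k k
    have := he k j k j
    rw [h0, hoff k j hij] at this
    simp [w, hij] at this
  · rw [Matrix.one_apply_ne hki, hoff k i hki]

end GLA8

open GLA8

/-- GL(4,2) is isomorphic to the alternating group A₈. -/
theorem gl_four_two_iso_alternating :
    Nonempty (GL (Fin 4) (ZMod 2) ≃* alternatingGroup (Fin 8)) := by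
  have hex : ∀ g : GL (Fin 4) (ZMod 2), ∃ σ : alternatingGroup (Fin 8), Rel g.1 σ := fun g =>
    exists_rel g.1 ((Matrix.isUnit_iff_isUnit_det _).1 g.isUnit).ne_zero
  choose f hf using hex
  let F : GL (Fin 4) (ZMod 2) →* alternatingGroup (Fin 8) := MonoidHom.mk' f fun g h =>
    Subtype.ext (rel_unique (hf (g * h)) (rel_mul (hf g) (hf h)))
  have hinj : Function.Injective F := by
    rw [injective_iff_map_eq_one]
    intro g hg
    have h := hf g
    have h1 : f g = 1 := hg
    rw [h1] at h
    exact Units.ext (rel_one_right h)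
  have hcard : Nat.card (GL (Fin 4) (ZMod 2)) = Nat.card (alternatingGroup (Fin 8)) := by
    rw [Matrix.card_GL_field, nat_card_alternatingGroup]
    simp [Fin.prod_univ_four, ZMod.card, Nat.factorial]
  exact ⟨MulEquiv.ofBijective F ((Nat.bijective_iff_injective_and_card F).2 ⟨hinj, hcard⟩)⟩
end
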